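/- Let q = 2^n, k a positive integer, d = gcd(n,k) with n/d odd and k ∉ {n/3, 2n/3}. Then for all α, β, γ ∈ F_q, the exponential sum S(α,β,γ) = Σ_{x ∈ F_q} (-1)^{Tr(α x^{2^{2k}+1} + β x^{2^k+1} + γ x)} lies in the set {0, 2^{(n+d)/2}, −2^{(n+d)/2}, 2^{(n+3d)/2}, −2^{(n+3d)/2}, 2^n}. -/

import Mathlib

open Module

/-- For an alternating form, the rank (dimension minus dimension of the radical) is even. -/
theorem LinearMap.BilinForm.IsAlt.even_finrank_add_finrank_orthogonal_top {K V : Type*} [Field K]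
    [AddCommGroup V] [Module K V] [FiniteDimensional K V] {B : LinearMap.BilinForm K V}
    (hB : B.IsAlt) : Even (finrank K V + finrank K (B.orthogonal ⊤)) := by
  obtain ⟨U, hU⟩ : ∃ U, Maximal (fun U : Submodule K V => U ≤ B.orthogonal U) U := by
    obtain ⟨U, -, hU⟩ := Set.Finite.exists_le_maximal (α := ℕ) (a := 0)
      (s := (fun U : Submodule K V => finrank K U) '' {U | U ≤ B.orthogonal U})
      ((Set.finite_Iic (finrank K V)).subset (by
        rintro _ ⟨U, -, rfl⟩
        exact U.finrank_le)) ⟨⊥, by simp, by simp⟩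
    obtain ⟨⟨U, hUo, rfl⟩, hmax⟩ := hU
    refine ⟨U, hUo, fun U' hU' hle => ?_⟩
    exact (Submodule.eq_of_le_of_finrank_le hle (hmax ⟨U', hU', rfl⟩
      (Submodule.finrank_mono hle))).ge
  have hUU : B.orthogonal U = U := by
    refine le_antisymm (fun x hx => ?_) hU.prop
    have hxU : ∀ u ∈ U, B u x = 0 := LinearMap.BilinForm.mem_orthogonal_iff.1 hx
    have hiso : U ⊔ K ∙ x ≤ B.orthogonal (U ⊔ K ∙ x) := by
      intro y hy
      rw [LinearMap.BilinForm.mem_orthogonal_iff]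
      intro z hz
      obtain ⟨u, hu, v, hv, rfl⟩ := Submodule.mem_sup.1 hy
      obtain ⟨u', hu', v', hv', rfl⟩ := Submodule.mem_sup.1 hz
      obtain ⟨a, rfl⟩ := Submodule.mem_span_singleton.1 hv
      obtain ⟨b, rfl⟩ := Submodule.mem_span_singleton.1 hv'
      have h1 : B u' u = 0 := LinearMap.BilinForm.mem_orthogonal_iff.1 (hU.prop hu) u' hu'
      have h2 : B x u = 0 := hB.isRefl _ _ (hxU u hu)
      simp [h1, h2, hxU u' hu', hB.self_eq_zero x]
    exact hU.le_of_ge hiso le_sup_left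
      (Submodule.mem_sup_right (Submodule.mem_span_singleton_self x))
  have htop : U ⊓ B.orthogonal ⊤ = B.orthogonal ⊤ := by
    refine inf_eq_right.2 ?_
    rw [← hUU]
    exact LinearMap.BilinForm.orthogonal_le le_top
  have h := LinearMap.BilinForm.finrank_add_finrank_orthogonal hB.isRefl U
  rw [htop, hUU] at h
  exact ⟨_, h.symm⟩

/-- A nonzero skew polynomial of degree at most `m` in an automorphism `σ` of `L` with fixed field
`K` has a kernel of `K`-dimension at most `m`. -/
theorem finrank_le_of_forall_sum_mul_pow_eq_zero {K L : Type*} [Field K] [Field L] [Algebra K L]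
    [FiniteDimensional K L] (σ : L ≃ₐ[K] L)
    (hσ : ∀ x, σ x = x → x ∈ Set.range (algebraMap K L)) (m : ℕ) (a : ℕ → L)
    (ha : ∃ i ≤ m, a i ≠ 0) (V : Submodule K L)
    (hV : ∀ x ∈ V, ∑ i ∈ Finset.range (m + 1), a i * (σ ^ i) x = 0) : finrank K V ≤ m := by
  induction m generalizing a V with
  | zero =>
    obtain ⟨i, hi, h0⟩ := ha
    obtain rfl : i = 0 := by omega
    have : V = ⊥ := by
      refine (Submodule.eq_bot_iff _).2 fun x hx => ?_
      simpa [h0] using hV x hx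
    simp [this]
  | succ m ih =>
    by_cases hbot : V = ⊥
    · rw [hbot, finrank_bot]
      exact Nat.zero_le _
    obtain ⟨z, hzV, hz⟩ := (Submodule.ne_bot_iff _).1 hbot
    -- the coefficients after the substitution `x = z * y`, and their tail sums
    set b : ℕ → L := fun i => a i * (σ ^ i) z with hb
    set c : ℕ → L := fun i => ∑ j ∈ Finset.Ico (i + 1) (m + 2), b j with hc
    have hc_last : c (m + 1) = 0 := by simp [hc]
    have hc_step : ∀ i ≤ m, c i = b (i + 1) + c (i + 1) := fun i hi =>
      Finset.sum_eq_sum_Ico_succ_bot (by omega) _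
    have hsum : b 0 + c 0 = 0 := by
      rw [← hV z hzV, Finset.range_eq_Ico, Finset.sum_eq_sum_Ico_succ_bot (by omega)]
    have habel : ∀ y, ∑ i ∈ Finset.range (m + 1), c i * (σ ^ i) (σ y - y)
        = ∑ i ∈ Finset.range (m + 2), b i * (σ ^ i) y := by
      intro y
      have key : ∀ r ≤ m + 1, ∑ i ∈ Finset.range r, c i * (σ ^ i) (σ y - y)
          = ∑ i ∈ Finset.range (r + 1), b i * (σ ^ i) y + c r * (σ ^ r) y := by
        intro r hr
        induction r with
        | zero => simp [← add_mul, hsum]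
        | succ r ihr =>
          rw [Finset.sum_range_succ, ihr (by omega), Finset.sum_range_succ _ (r + 1),
            hc_step r (by omega), map_sub, pow_succ, AlgEquiv.mul_apply]
          ring
      rw [key _ le_rfl, hc_last, zero_mul, add_zero]
    have hcne : ∃ i ≤ m, c i ≠ 0 := by
      by_contra! h
      obtain ⟨i, hi, hai⟩ := ha
      have hbi : b i ≠ 0 := mul_ne_zero hai ((map_ne_zero (σ ^ i)).2 hz)
      apply hbi
      have h' : ∀ i ≤ m + 1, c i = 0 := fun i hi => by
        rcases Nat.lt_or_eq_of_le hi with h1 | rfl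
        · exact h i (by omega)
        · exact hc_last
      cases i with
      | zero => simpa [h' 0 (by omega)] using hsum
      | succ i => simpa [h' i (by omega), h' (i + 1) hi] using (hc_step i (by omega)).symm
    let T : L →ₗ[K] L := (σ.toLinearMap - LinearMap.id) ∘ₗ LinearMap.mulLeft K z⁻¹
    have hT : ∀ x, T x = σ (z⁻¹ * x) - z⁻¹ * x := fun x => rfl
    have hmap : finrank K (V.map T) ≤ m := by
      refine ih c hcne _ ?_
      rintro _ ⟨x, hx, rfl⟩
      rw [hT, habel, ← hV x hx]
      refine Finset.sum_congr rfl fun i _ => ?_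
      rw [hb, mul_assoc, ← map_mul, mul_inv_cancel_left₀ hz]
    have hker : finrank K (LinearMap.ker (T.domRestrict V)) ≤ 1 := by
      have hle : (LinearMap.ker (T.domRestrict V)).map V.subtype ≤ K ∙ z := by
        rintro _ ⟨x, hx, rfl⟩
        have hx0 : T x = 0 := hx
        obtain ⟨r, hr⟩ := hσ _ (sub_eq_zero.1 ((hT x).symm.trans hx0))
        refine Submodule.mem_span_singleton.2 ⟨r, ?_⟩
        rw [Algebra.smul_def, hr, mul_comm, mul_inv_cancel_left₀ hz]
        rfl
      rw [← Submodule.finrank_map_subtype_eq]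
      exact (Submodule.finrank_mono hle).trans (finrank_span_singleton hz).le
    have hrn := LinearMap.finrank_range_add_finrank_ker (T.domRestrict V)
    rw [LinearMap.range_domRestrict] at hrn
    omega

/-- The sign character of `ZMod 2` summed along a homomorphism. -/
theorem sum_neg_one_pow_val_eq {G : Type*} [AddCommGroup G] [Fintype G] (g : G → ZMod 2)
    (hg : ∀ x y, g (x + y) = g x + g y) :
    (∀ x, g x = 0) ∧ ∑ x, (-1 : ℤ) ^ (g x).val = Fintype.card G ∨
    (∃ x, g x ≠ 0) ∧ ∑ x, (-1 : ℤ) ^ (g x).val = 0 := by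
  by_cases h : ∀ x, g x = 0
  · exact Or.inl ⟨h, by simp [h]⟩
  · push Not at h
    refine Or.inr ⟨h, ?_⟩
    obtain ⟨w, hw⟩ := h
    have hflip : ∀ s t : ZMod 2, t ≠ 0 → (-1 : ℤ) ^ (s + t).val = -(-1 : ℤ) ^ s.val := by decide
    have := Equiv.sum_comp (Equiv.addRight w) fun x => (-1 : ℤ) ^ (g x).val
    simp only [Equiv.coe_addRight, hg, hflip _ _ hw, Finset.sum_neg_distrib] at this
    omega

theorem eq_zero_of_forall_trace_mul_eq_zero (K : Type*) {L : Type*} [Field K] [Field L]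
    [Algebra K L] [FiniteDimensional K L] [Algebra.IsSeparable K L] {a : L}
    (h : ∀ x, Algebra.trace K L (x * a) = 0) : a = 0 :=
  (traceForm_nondegenerate K L).2 a h

/-- The square of the exponential sum of an `𝔽₂`-valued quadratic function with polarization
`Tr (x * A y)`. -/
theorem sq_sum_neg_one_pow_val {L : Type*} [Field L] [Fintype L] [Algebra (ZMod 2) L]
    (A : L →ₗ[ZMod 2] L) (f : L → ZMod 2)
    (hf : ∀ x y, f (x + y) = f x + f y + Algebra.trace (ZMod 2) L (x * A y)) :
    (∑ x, (-1 : ℤ) ^ (f x).val) = 0 ∨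
    (∑ x, (-1 : ℤ) ^ (f x).val) ^ 2 = Nat.card L * Nat.card (LinearMap.ker A) := by
  classical
  have hmul : ∀ s t : ZMod 2, (-1 : ℤ) ^ (s + t).val = (-1 : ℤ) ^ s.val * (-1 : ℤ) ^ t.val := by
    decide
  have hinner : ∀ u, ∑ x, (-1 : ℤ) ^ (Algebra.trace (ZMod 2) L (x * A u)).val
      = if A u = 0 then (Fintype.card L : ℤ) else 0 := by
    intro u
    split_ifs with hu
    · simp [hu]
    · rcases sum_neg_one_pow_val_eq (fun x => Algebra.trace (ZMod 2) L (x * A u))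
        (fun x y => by rw [add_mul, map_add]) with ⟨h, -⟩ | ⟨-, h⟩
      · exact absurd (eq_zero_of_forall_trace_mul_eq_zero _ h) hu
      · exact h
  have hsq : (∑ x, (-1 : ℤ) ^ (f x).val) ^ 2
      = Fintype.card L * ∑ u : LinearMap.ker A, (-1 : ℤ) ^ (f u).val := by
    calc (∑ x, (-1 : ℤ) ^ (f x).val) ^ 2
        = ∑ x, ∑ u, (-1 : ℤ) ^ (f x).val * (-1 : ℤ) ^ (f (x + u)).val := by
          rw [sq, Finset.sum_mul]
          refine Finset.sum_congr rfl fun x _ => ?_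
          rw [← Finset.mul_sum]
          congr 1
          exact (Equiv.sum_comp (Equiv.addLeft x) fun y => (-1 : ℤ) ^ (f y).val).symm
      _ = ∑ u, (-1 : ℤ) ^ (f u).val *
            ∑ x, (-1 : ℤ) ^ (Algebra.trace (ZMod 2) L (x * A u)).val := by
          rw [Finset.sum_comm]
          refine Finset.sum_congr rfl fun u _ => ?_
          rw [Finset.mul_sum]
          refine Finset.sum_congr rfl fun x _ => ?_
          have hself : ∀ s : ZMod 2, (-1 : ℤ) ^ s.val * (-1 : ℤ) ^ s.val = 1 := by decide
          rw [hf, hmul, hmul, ← mul_assoc, ← mul_assoc, hself, one_mul]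
      _ = Fintype.card L * ∑ u : LinearMap.ker A, (-1 : ℤ) ^ (f u).val := by
          simp only [hinner, mul_ite, mul_zero]
          rw [← Finset.sum_filter, ← Finset.sum_mul, mul_comm]
          congr 1
          exact Finset.sum_subtype _ (fun x => by simp) _
  rcases sum_neg_one_pow_val_eq (fun u : LinearMap.ker A => f u) (fun x y => by
      have hy : A y = 0 := y.2
      simp [hf, hy]) with ⟨-, h⟩ | ⟨-, h⟩
  · right
    rw [hsq, h, Nat.card_eq_fintype_card, Nat.card_eq_fintype_card]
  · left
    rw [h, mul_zero] at hsq
    exact pow_eq_zero_iff two_ne_zero |>.1 hsq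

section Polar

variable {K L : Type*} [Field K] [Field L] [Algebra K L]

/-- The linear operator `A` for which `Tr (y * A x)` is the polarization of
`x ↦ Tr (α * (σ (σ x) * x) + β * (σ x * x))`. -/
noncomputable def polarMap (σ : L ≃ₐ[K] L) (α β : L) : L →ₗ[K] L :=
  LinearMap.mulLeft K α ∘ₗ σ.toLinearMap ∘ₗ σ.toLinearMap
    + σ.symm.toLinearMap ∘ₗ σ.symm.toLinearMap ∘ₗ LinearMap.mulLeft K α
    + LinearMap.mulLeft K β ∘ₗ σ.toLinearMap
    + σ.symm.toLinearMap ∘ₗ LinearMap.mulLeft K β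

theorem polarMap_apply (σ : L ≃ₐ[K] L) (α β x : L) :
    polarMap σ α β x
      = α * σ (σ x) + σ.symm (σ.symm (α * x)) + β * σ x + σ.symm (β * x) := rfl

theorem trace_mul_polarMap (σ : L ≃ₐ[K] L) (α β x y : L) :
    Algebra.trace K L (x * polarMap σ α β y)
      = Algebra.trace K L (α * (σ (σ y) * x + σ (σ x) * y) + β * (σ y * x + σ x * y)) := by
  have h1 : Algebra.trace K L (x * σ.symm (σ.symm (α * y)))
      = Algebra.trace K L (α * (σ (σ x) * y)) := by
    rw [← Algebra.trace_eq_of_algEquiv σ, ← Algebra.trace_eq_of_algEquiv σ]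
    simp only [map_mul, AlgEquiv.apply_symm_apply]
    ring_nf
  have h2 : Algebra.trace K L (x * σ.symm (β * y)) = Algebra.trace K L (β * (σ x * y)) := by
    rw [← Algebra.trace_eq_of_algEquiv σ]
    simp only [map_mul, AlgEquiv.apply_symm_apply]
    ring_nf
  rw [polarMap_apply]
  simp only [mul_add, map_add, h1, h2]
  ring_nf

theorem even_finrank_add_finrank_ker_polarMap [CharP L 2] [FiniteDimensional K L]
    [Algebra.IsSeparable K L] (σ : L ≃ₐ[K] L) (α β : L) :
    Even (finrank K L + finrank K (LinearMap.ker (polarMap σ α β))) := by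
  let B : LinearMap.BilinForm K L := (Algebra.traceForm K L).compRight (polarMap σ α β)
  have hBapply : ∀ x y, B x y = Algebra.trace K L (x * polarMap σ α β y) := fun x y => rfl
  have hB : B.IsAlt := fun x => by
    rw [hBapply, trace_mul_polarMap, CharTwo.add_self_eq_zero, CharTwo.add_self_eq_zero]
    simp
  have hker : B.orthogonal ⊤ = LinearMap.ker (polarMap σ α β) := by
    ext y
    simp only [LinearMap.BilinForm.mem_orthogonal_iff, LinearMap.mem_ker, hBapply,
      Submodule.mem_top, true_imp_iff]
    exact ⟨eq_zero_of_forall_trace_mul_eq_zero K, fun h x => by simp [h]⟩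
  rw [← hker]
  exact hB.even_finrank_add_finrank_orthogonal_top

theorem finrank_ker_polarMap_le [FiniteDimensional K L] (σ : L ≃ₐ[K] L)
    (hσ : ∀ x, σ x = x → x ∈ Set.range (algebraMap K L)) {α β : L} (h : α ≠ 0 ∨ β ≠ 0) :
    finrank K (LinearMap.ker (polarMap σ α β)) ≤ 4 := by
  let a : ℕ → L := fun i =>
    if i = 0 then α else if i = 1 then σ β else if i = 3 then σ (σ β)
    else if i = 4 then σ (σ α) else 0
  refine finrank_le_of_forall_sum_mul_pow_eq_zero σ hσ 4 a ?_ _ fun x hx => ?_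
  · rcases h with h | h
    · exact ⟨0, by simp, by simpa [a] using h⟩
    · exact ⟨1, by simp, by simpa [a] using h⟩
  · have hx' : σ (σ (polarMap σ α β x)) = 0 := by
      rw [LinearMap.mem_ker.1 hx, map_zero, map_zero]
    rw [polarMap_apply] at hx'
    simp only [map_add, map_mul, AlgEquiv.apply_symm_apply] at hx'
    simp only [Finset.sum_range_succ, Finset.sum_range_zero, a, pow_succ, pow_zero,
      AlgEquiv.mul_apply, AlgEquiv.one_apply]
    norm_num
    rw [← hx']
    ring

end Polar

/-- For an automorphism `σ` of odd order `n / gcd n k` of a field with `2 ^ n` elements, the kernel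
of `polarMap σ α β` has dimension `1` or `3` over the fixed field of `σ`. -/
theorem card_ker_polarMap {n k : ℕ} {L : Type*} [Field L] [Finite L]
    [Algebra (ZMod 2) L] (hL : finrank (ZMod 2) L = n) (σ : L ≃ₐ[ZMod 2] L)
    (hord : orderOf σ = n / n.gcd k) (hodd : Odd (n / n.gcd k)) {α β : L} (h : α ≠ 0 ∨ β ≠ 0) :
    Nat.card (LinearMap.ker (polarMap σ α β)) = 2 ^ n.gcd k ∨
    Nat.card (LinearMap.ker (polarMap σ α β)) = 2 ^ (3 * n.gcd k) := by
  have : CharP L 2 := charP_of_injective_algebraMap (algebraMap (ZMod 2) L).injective 2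
  let H := Subgroup.zpowers σ
  let K := IntermediateField.fixedField H
  have hmem : ∀ x, σ x = x → x ∈ K := by
    intro x hx
    rw [IntermediateField.mem_fixedField_iff]
    intro f hf
    have : H ≤ MulAction.stabilizer (L ≃ₐ[ZMod 2] L) x := by
      rw [Subgroup.zpowers_le]
      exact hx
    exact this hf
  let τ : L ≃ₐ[K] L := AlgEquiv.ofRingEquiv (f := σ.toRingEquiv)
    (fun x => (IntermediateField.mem_fixedField_iff H _).1 x.2 σ (Subgroup.mem_zpowers σ))
  have hrank : finrank K L = n / n.gcd k := by
    rw [IntermediateField.finrank_fixedField_eq_card, Nat.card_zpowers, hord]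
  have hcardK : Nat.card K = 2 ^ n.gcd k := by
    have h1 : Nat.card L = 2 ^ n := by
      rw [Module.natCard_eq_pow_finrank (K := ZMod 2), hL, Nat.card_zmod]
    rw [Module.natCard_eq_pow_finrank (K := K), hrank] at h1
    refine Nat.pow_left_injective (n := n / n.gcd k) hodd.pos.ne' ?_
    simp only [h1, ← pow_mul, Nat.mul_div_cancel' (Nat.gcd_dvd_left n k)]
  have hker : Nat.card (LinearMap.ker (polarMap σ α β))
      = Nat.card (LinearMap.ker (polarMap τ α β)) := rfl
  rw [hker, Module.natCard_eq_pow_finrank (K := K), hcardK]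
  have hle := finrank_ker_polarMap_le τ (fun x hx => ⟨⟨x, hmem x hx⟩, rfl⟩) h
  have heven := even_finrank_add_finrank_ker_polarMap τ α β
  rw [hrank, Nat.even_add, ← Nat.not_odd_iff_even] at heven
  have hw : ¬ Even (finrank K (LinearMap.ker (polarMap τ α β))) := fun he => heven.2 he hodd
  generalize finrank K (LinearMap.ker (polarMap τ α β)) = w at *
  interval_cases w
  · exact absurd (by decide) hw
  · left; simp
  · exact absurd (by decide) hw
  · right; rw [← pow_mul, mul_comm]
  · exact absurd (by decide) hw

/-- with d = gcd(n,k), n/d odd and k ∉ {n/3, 2n/3}, every value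
S(α,β,γ) lies in {0, ±2^{(n+d)/2}, ±2^{(n+3d)/2}, 2^n}. -/
theorem stmt_14 (n k : ℕ) (hn : 0 < n) (hk : 0 < k) (d : ℕ) (hd : d = Nat.gcd n k)
    (hodd : Odd (n / d)) (hk1 : 3 * k ≠ n) (hk2 : 3 * k ≠ 2 * n)
    [Fintype (GaloisField 2 n)] (α β γ : GaloisField 2 n) :
    (∑ x : GaloisField 2 n,
        (-1 : ℤ) ^ (Algebra.trace (ZMod 2) (GaloisField 2 n)
          (α * x ^ (2 ^ (2 * k) + 1) + β * x ^ (2 ^ k + 1) + γ * x)).val)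
      ∈ ({0, 2 ^ ((n + d) / 2), -2 ^ ((n + d) / 2),
          2 ^ ((n + 3 * d) / 2), -2 ^ ((n + 3 * d) / 2), 2 ^ n} : Set ℤ) := by
  have hcard : Nat.card (GaloisField 2 n) = 2 ^ n := GaloisField.card 2 n hn.ne'
  by_cases h : α = 0 ∧ β = 0
  · obtain ⟨rfl, rfl⟩ := h
    simp only [zero_mul, zero_add]
    rcases sum_neg_one_pow_val_eq
      (fun x => Algebra.trace (ZMod 2) (GaloisField 2 n) (γ * x))
      (fun x y => by rw [mul_add, map_add]) with ⟨-, h⟩ | ⟨-, h⟩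
    · rw [h, ← Nat.card_eq_fintype_card, hcard]
      simp
    · simp [h]
  have h' : α ≠ 0 ∨ β ≠ 0 := by tauto
  have hfin : finrank (ZMod 2) (GaloisField 2 n) = n := GaloisField.finrank 2 hn.ne'
  let φ := FiniteField.frobeniusAlgEquivOfAlgebraic (ZMod 2) (GaloisField 2 n)
  have hφ : orderOf φ = n :=
    (FiniteField.orderOf_frobeniusAlgEquivOfAlgebraic _ _).trans hfin
  let σ := φ ^ k
  have hσ : ∀ x, σ x = x ^ 2 ^ k := fun x => by
    rw [AlgEquiv.coe_pow, FiniteField.coe_frobeniusAlgEquivOfAlgebraic_iterate, ZMod.card]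
  have hord : orderOf σ = n / n.gcd k := by
    rw [orderOf_pow, hφ]
  have hterm : ∀ x, α * x ^ (2 ^ (2 * k) + 1) + β * x ^ (2 ^ k + 1) + γ * x
      = α * (σ (σ x) * x) + β * (σ x * x) + γ * x := fun x => by
    rw [hσ, hσ, ← pow_mul, ← pow_add, ← two_mul, pow_succ, pow_succ]
  simp only [hterm]
  have hS := sq_sum_neg_one_pow_val (polarMap σ α β)
    (fun x => Algebra.trace (ZMod 2) _ (α * (σ (σ x) * x) + β * (σ x * x) + γ * x))
    (fun x y => by
      rw [trace_mul_polarMap, ← map_add, ← map_add]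
      congr 1
      simp only [map_add]
      ring)
  generalize (∑ x, (-1 : ℤ) ^ (Algebra.trace (ZMod 2) (GaloisField 2 n)
    (α * (σ (σ x) * x) + β * (σ x * x) + γ * x)).val) = S at hS ⊢
  rcases hS with rfl | hS
  · simp
  subst hd
  have hsplit : n = n.gcd k * (n / n.gcd k) := (Nat.mul_div_cancel' (Nat.gcd_dvd_left n k)).symm
  have hE1 : Even (n + n.gcd k) := by
    have : n + n.gcd k = n.gcd k * (n / n.gcd k + 1) := by rw [mul_add, ← hsplit, mul_one]
    rw [this]
    exact hodd.add_one.mul_left _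
  have hE3 : Even (n + 3 * n.gcd k) := by
    have : n + 3 * n.gcd k = n + n.gcd k + 2 * n.gcd k := by ring
    rw [this]
    exact hE1.add (even_two_mul _)
  rw [hcard] at hS
  rcases card_ker_polarMap hfin σ hord hodd h' with hc | hc
  · rw [hc] at hS
    have : S ^ 2 = (2 ^ ((n + n.gcd k) / 2)) ^ 2 := by
      rw [hS, ← pow_mul, Nat.div_mul_cancel hE1.two_dvd]
      push_cast
      ring
    rcases sq_eq_sq_iff_eq_or_eq_neg.1 this with rfl | rfl <;> simp
  · rw [hc] at hS
    have : S ^ 2 = (2 ^ ((n + 3 * n.gcd k) / 2)) ^ 2 := by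
      rw [hS, ← pow_mul, Nat.div_mul_cancel hE3.two_dvd]
      push_cast
      ring
    rcases sq_eq_sq_iff_eq_or_eq_neg.1 this with rfl | rfl <;> simp
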